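/- There exists an absolute constant C with the following property. Let μ be a probability distribution on ℝⁿ with zero mean and covariance matrix Σ_pop, supported in a centered Euclidean ball of radius √r. Let ε ∈ (0,1) and t ≥ 1, and suppose m ≥ C·(t/ε)²·‖Σ_pop‖₂^{−1}·r·log n. If X₁,…,X_m are drawn i.i.d. from μ and Σ̂ = (1/m)·Σ_{i=1}^m XᵢXᵢᵀ is the sample covariance matrix, then with probability at least 1 − n^{−t²} one has ‖Σ̂ − Σ_pop‖₂ ≤ ε·‖Σ_pop‖₂. -/

import Mathlib

open MeasureTheory Matrix

noncomputable section

/-- The ℓ¹-norm of a vector. -/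
def l1Norm {m : ℕ} (v : Fin m → ℝ) : ℝ := ∑ i, |v i|

/-- The Frobenius norm of a square real matrix. -/
def frobNorm {n : ℕ} (A : Matrix (Fin n) (Fin n) ℝ) : ℝ :=
  Real.sqrt (∑ i, ∑ j, (A i j) ^ 2)

/-- The rank-one sensing map `Z_i(X) = zᵢᵀ X zᵢ`. -/
def sensing {n m : ℕ} (z : Fin m → Fin n → ℝ) (X : Matrix (Fin n) (Fin n) ℝ) :
    Fin m → ℝ := fun i => z i ⬝ᵥ X.mulVec (z i)

/-- The singular values of a square real matrix (unordered), as square roots of the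
eigenvalues of `A * Aᴴ`. -/
def singVal {n : ℕ} (A : Matrix (Fin n) (Fin n) ℝ) (i : Fin n) : ℝ :=
  Real.sqrt ((Matrix.isHermitian_mul_conjTranspose_self A).eigenvalues i)

/-- Sum of the `p` smallest singular values of `A`, i.e. `‖[A]_{-p}‖_*`. -/
def sumSmallestSingVals {n : ℕ} (A : Matrix (Fin n) (Fin n) ℝ) (p : ℕ) : ℝ :=
  sInf {t | ∃ s : Finset (Fin n), s.card = p ∧ t = ∑ i ∈ s, singVal A i}

/-- The nuclear norm of a square real matrix: sum of its singular values. -/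
def nucNorm {n : ℕ} (A : Matrix (Fin n) (Fin n) ℝ) : ℝ := ∑ i, singVal A i

/-- The largest singular value of a square real matrix. -/
def sigmaMax {n : ℕ} (A : Matrix (Fin n) (Fin n) ℝ) : ℝ :=
  Real.sqrt (⨆ i, (Matrix.isHermitian_mul_conjTranspose_self A).eigenvalues i)

/-- The smallest singular value of a square real matrix. -/
def sigmaMin {n : ℕ} (A : Matrix (Fin n) (Fin n) ℝ) : ℝ :=
  Real.sqrt (⨅ i, (Matrix.isHermitian_mul_conjTranspose_self A).eigenvalues i)

/-- `μ` is the uniform distribution on the unit sphere of ℝⁿ: a probability measure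
supported on the unit sphere and invariant under orthogonal transformations. -/
def IsUniformOnSphere {n : ℕ} (μ : Measure (Fin n → ℝ)) : Prop :=
  IsProbabilityMeasure μ ∧ μ {z | ∑ i, (z i) ^ 2 = 1} = 1 ∧
    ∀ U : Matrix (Fin n) (Fin n) ℝ, Uᵀ * U = 1 → μ.map (U.mulVec) = μ

/-- The sample second-moment matrix `Σ = (1/m) ∑ zᵢ zᵢᵀ`. -/
def covM {n m : ℕ} (z : Fin m → Fin n → ℝ) : Matrix (Fin n) (Fin n) ℝ :=
  (m : ℝ)⁻¹ • ∑ i, vecMulVec (z i) (z i)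

/-- The induced asymmetric sensing map `Z'_i(X) = ½ (Z_{2i-1}(X) - Z_{2i}(X))`. -/
def sensingAsym {n m : ℕ} (z : Fin m → Fin n → ℝ) (X : Matrix (Fin n) (Fin n) ℝ) :
    Fin (m / 2) → ℝ := fun i =>
  (sensing z X ⟨2 * i, by have := i.2; omega⟩ - sensing z X ⟨2 * i + 1, by have := i.2; omega⟩) / 2

/-- The Symmetrized Restricted Uniform Boundedness property of order `R` with
constants `C₁, C₂` for the sensing vectors `z`. -/
def HasSRUB {n m : ℕ} (z : Fin m → Fin n → ℝ) (R : ℕ) (C₁ C₂ : ℝ) : Prop :=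
  ∀ X : Matrix (Fin n) (Fin n) ℝ, X.IsHermitian → X ≠ 0 → X.rank ≤ R →
    C₁ ≤ l1Norm (sensingAsym z X) / ((m / 2 : ℕ) : ℝ) / frobNorm X ∧
    l1Norm (sensingAsym z X) / ((m / 2 : ℕ) : ℝ) / frobNorm X ≤ C₂

/-! ### Trace inequalities for exponentials of symmetric matrices -/

section MatrixLemmas

variable {n : ℕ}

/-- Orthogonal diagonalisation of a real symmetric matrix. -/
theorem exists_eq_conj_diagonal_eigenvalues {A : Matrix (Fin n) (Fin n) ℝ}
    (hA : A.IsHermitian) :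
    ∃ U : Matrix (Fin n) (Fin n) ℝ, Uᵀ * U = 1 ∧ U * Uᵀ = 1 ∧
      A = U * diagonal hA.eigenvalues * Uᵀ := by
  have h₁ : (hA.eigenvectorUnitary : Matrix (Fin n) (Fin n) ℝ)ᵀ * hA.eigenvectorUnitary.1 = 1 := by
    simpa [star_eq_conjTranspose] using Unitary.coe_star_mul_self hA.eigenvectorUnitary
  refine ⟨hA.eigenvectorUnitary.1, h₁, mul_eq_one_comm.mp h₁, ?_⟩
  have h := hA.spectral_theorem
  rw [Unitary.conjStarAlgAut_apply] at h
  simpa [star_eq_conjTranspose, Function.comp_def] using h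

/-- Exponential of an orthogonally diagonalised matrix. -/
theorem exp_smul_conj_diagonal {U : Matrix (Fin n) (Fin n) ℝ} (hU : Uᵀ * U = 1)
    (d : Fin n → ℝ) (θ : ℝ) :
    NormedSpace.exp (θ • (U * diagonal d * Uᵀ)) =
      U * diagonal (fun i => Real.exp (θ * d i)) * Uᵀ := by
  have h_inv : U⁻¹ = Uᵀ := inv_eq_left_inv hU
  have h_smul : θ • (U * diagonal d * Uᵀ) = U * diagonal (θ • d) * U⁻¹ := by
    rw [h_inv, ← Matrix.smul_mul, ← Matrix.mul_smul, ← diagonal_smul]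
  rw [h_smul, exp_conj _ _ (IsUnit.of_mul_eq_one _ (mul_eq_one_comm.mp hU)), exp_diagonal, h_inv]
  congr 3
  ext i
  rw [Pi.coe_exp, Real.exp_eq_exp_ℝ]
  rfl

/-- Quadratic form of an orthogonally diagonalised matrix. -/
theorem dotProduct_conj_diagonal_mulVec (U : Matrix (Fin n) (Fin n) ℝ) (d v : Fin n → ℝ) :
    v ⬝ᵥ (U * diagonal d * Uᵀ) *ᵥ v = ∑ k, d k * (Uᵀ *ᵥ v) k ^ 2 := by
  rw [← mulVec_mulVec, ← mulVec_mulVec, dotProduct_mulVec, ← mulVec_transpose, dotProduct]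
  refine Finset.sum_congr rfl fun k _ => ?_
  rw [mulVec_diagonal]
  ring

theorem sum_sq_transpose_mulVec {U : Matrix (Fin n) (Fin n) ℝ} (hU : U * Uᵀ = 1)
    (v : Fin n → ℝ) : ∑ k, (Uᵀ *ᵥ v) k ^ 2 = v ⬝ᵥ v := by
  have h := dotProduct_conj_diagonal_mulVec U 1 v
  rw [show diagonal (1 : Fin n → ℝ) = 1 from diagonal_one, Matrix.mul_one, hU, one_mulVec] at h
  simpa using h.symm

/-- Trace of a product of a symmetric form with a diagonalised matrix. -/
theorem trace_mul_conj_diagonal (M U : Matrix (Fin n) (Fin n) ℝ) (d : Fin n → ℝ) :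
    (M * (U * diagonal d * Uᵀ)).trace = ∑ k, d k * (U.col k ⬝ᵥ M *ᵥ U.col k) := by
  rw [← Matrix.mul_assoc, trace_mul_comm, ← Matrix.mul_assoc, ← Matrix.mul_assoc, trace]
  refine Finset.sum_congr rfl fun k _ => ?_
  rw [diag_apply, mul_diagonal, mul_comm, Matrix.mul_assoc]
  rfl

/-- Pairing a nonnegative quadratic form with the exponential of a symmetric matrix. -/
theorem trace_mul_exp_nonneg {M A : Matrix (Fin n) (Fin n) ℝ} (hA : A.IsHermitian)
    (hM : ∀ v, 0 ≤ v ⬝ᵥ M *ᵥ v) (θ : ℝ) :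
    0 ≤ (M * NormedSpace.exp (θ • A)).trace := by
  obtain ⟨U, hU, -, hAU⟩ := exists_eq_conj_diagonal_eigenvalues hA
  rw [hAU, exp_smul_conj_diagonal hU, trace_mul_conj_diagonal]
  exact Finset.sum_nonneg fun k _ => mul_nonneg (Real.exp_pos _).le (hM _)

theorem sub_mul_exp_sub_exp_le (a b : ℝ) :
    (a - b) * (Real.exp a - Real.exp b) ≤ (a - b) ^ 2 * (Real.exp a + Real.exp b) := by
  wlog hab : b ≤ a generalizing a b
  · linarith [this b a (le_of_not_ge hab)]
  have h : Real.exp a - Real.exp b ≤ (a - b) * Real.exp a := by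
    have h₁ := mul_le_mul_of_nonneg_left (Real.add_one_le_exp (b - a)) (Real.exp_pos a).le
    rw [← Real.exp_add, add_sub_cancel] at h₁
    linarith
  have h₂ := mul_le_mul_of_nonneg_left h (sub_nonneg.mpr hab)
  nlinarith [mul_nonneg (sq_nonneg (a - b)) (Real.exp_pos b).le]

/-- Mean value inequality for the trace of matrix exponentials. -/
theorem mul_trace_sub_mul_exp_sub_exp_le {A B : Matrix (Fin n) (Fin n) ℝ}
    (hA : A.IsHermitian) (hB : B.IsHermitian) (θ : ℝ) :
    θ * ((A - B) * (NormedSpace.exp (θ • A) - NormedSpace.exp (θ • B))).trace ≤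
      θ ^ 2 * ((A - B) * (A - B) *
        (NormedSpace.exp (θ • A) + NormedSpace.exp (θ • B))).trace := by
  have hAB : (A - B)ᵀ = A - B := by simpa using (hA.sub hB).eq
  obtain ⟨U, hU₁, hU₂, hAU⟩ := exists_eq_conj_diagonal_eigenvalues hA
  obtain ⟨V, hV₁, hV₂, hBV⟩ := exists_eq_conj_diagonal_eigenvalues hB
  have hexpA := exp_smul_conj_diagonal hU₁ hA.eigenvalues θ
  have hexpB := exp_smul_conj_diagonal hV₁ hB.eigenvalues θ
  rw [← hAU] at hexpA
  rw [← hBV] at hexpB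
  rw [hexpA, hexpB]
  set d := hA.eigenvalues
  set e := hB.eigenvalues
  set f : Fin n → ℝ := fun i => Real.exp (θ * d i)
  set g : Fin n → ℝ := fun i => Real.exp (θ * e i)
  set Q := Uᵀ * V with hQ
  have hdiff (a b : Fin n → ℝ) (i j : Fin n) :
      (Uᵀ * (U * diagonal a * Uᵀ - V * diagonal b * Vᵀ) * V) i j = (a i - b j) * Q i j := by
    have : Uᵀ * (U * diagonal a * Uᵀ - V * diagonal b * Vᵀ) * V =
        diagonal a * Q - Q * diagonal b := by
      calc _ = (Uᵀ * U) * diagonal a * (Uᵀ * V) - (Uᵀ * V) * diagonal b * (Vᵀ * V) := by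
            noncomm_ring
        _ = _ := by rw [hU₁, hV₁]; simp [hQ]
    rw [this, Matrix.sub_apply, diagonal_mul, mul_diagonal]
    ring
  set R := Uᵀ * (A - B) * V with hR
  have hRij (i j : Fin n) : R i j = (d i - e j) * Q i j := by
    rw [hR]
    conv_lhs => rw [hAU, hBV]
    exact hdiff d e i j
  have hRt : Rᵀ = Vᵀ * (A - B) * U := by
    rw [hR, transpose_mul, transpose_mul, transpose_transpose, hAB, Matrix.mul_assoc]
  have h_left : ((A - B) * (U * diagonal f * Uᵀ - V * diagonal g * Vᵀ)).trace =
      ∑ i, ∑ j, ((d i - e j) * Q i j) * ((f i - g j) * Q i j) := by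
    set N := U * diagonal f * Uᵀ - V * diagonal g * Vᵀ
    have : ((A - B) * N).trace = (Rᵀ * (Uᵀ * N * V)).trace := by
      calc _ = ((V * Vᵀ) * ((A - B) * (U * Uᵀ) * N)).trace := by rw [hU₂, hV₂]; simp
        _ = (V * (Vᵀ * (A - B) * U * Uᵀ * N)).trace := by simp only [Matrix.mul_assoc]
        _ = _ := by rw [trace_mul_comm, hRt]; simp only [Matrix.mul_assoc]
    rw [this, trace, Finset.sum_comm]
    refine Finset.sum_congr rfl fun j _ => ?_
    rw [diag_apply, mul_apply]
    refine Finset.sum_congr rfl fun i _ => ?_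
    rw [transpose_apply, hRij, hdiff]
  have h_right₁ : ((A - B) * (A - B) * (U * diagonal f * Uᵀ)).trace =
      ∑ i, ∑ j, f i * ((d i - e j) * Q i j) ^ 2 := by
    have : ((A - B) * (A - B) * (U * diagonal f * Uᵀ)).trace = (diagonal f * (R * Rᵀ)).trace := by
      calc _ = ((A - B) * (V * Vᵀ) * (A - B) * (U * diagonal f * Uᵀ)).trace := by
            rw [hV₂]; simp
        _ = ((A - B) * V * Vᵀ * (A - B) * U * diagonal f * Uᵀ).trace := by
            simp only [Matrix.mul_assoc]
        _ = (Uᵀ * ((A - B) * V * Vᵀ * (A - B) * U * diagonal f)).trace := trace_mul_comm _ _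
        _ = (R * Rᵀ * diagonal f).trace := by rw [hRt, hR]; simp only [Matrix.mul_assoc]
        _ = _ := trace_mul_comm _ _
    rw [this, trace]
    refine Finset.sum_congr rfl fun i _ => ?_
    rw [diag_apply, diagonal_mul, mul_apply, Finset.mul_sum]
    refine Finset.sum_congr rfl fun j _ => ?_
    rw [transpose_apply, hRij, sq]
  have h_right₂ : ((A - B) * (A - B) * (V * diagonal g * Vᵀ)).trace =
      ∑ i, ∑ j, g j * ((d i - e j) * Q i j) ^ 2 := by
    have : ((A - B) * (A - B) * (V * diagonal g * Vᵀ)).trace = (diagonal g * (Rᵀ * R)).trace := by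
      calc _ = ((A - B) * (U * Uᵀ) * (A - B) * (V * diagonal g * Vᵀ)).trace := by
            rw [hU₂]; simp
        _ = ((A - B) * U * Uᵀ * (A - B) * V * diagonal g * Vᵀ).trace := by
            simp only [Matrix.mul_assoc]
        _ = (Vᵀ * ((A - B) * U * Uᵀ * (A - B) * V * diagonal g)).trace := trace_mul_comm _ _
        _ = (Rᵀ * R * diagonal g).trace := by rw [hRt, hR]; simp only [Matrix.mul_assoc]
        _ = _ := trace_mul_comm _ _
    rw [this, trace, Finset.sum_comm]
    refine Finset.sum_congr rfl fun j _ => ?_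
    rw [diag_apply, diagonal_mul, mul_apply, Finset.mul_sum]
    refine Finset.sum_congr rfl fun i _ => ?_
    rw [transpose_apply, hRij, sq]
  rw [h_left, Matrix.mul_add, trace_add, h_right₁, h_right₂, ← Finset.sum_add_distrib,
    Finset.mul_sum, Finset.mul_sum]
  refine Finset.sum_le_sum fun i _ => ?_
  rw [← Finset.sum_add_distrib, Finset.mul_sum, Finset.mul_sum]
  refine Finset.sum_le_sum fun j _ => ?_
  have h := mul_le_mul_of_nonneg_right (sub_mul_exp_sub_exp_le (θ * d i) (θ * e j))
    (sq_nonneg (Q i j))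
  calc _ = (θ * d i - θ * e j) * (f i - g j) * Q i j ^ 2 := by ring
    _ ≤ _ := h
    _ = _ := by ring

theorem isHermitian_vecMulVec_self (x : Fin n → ℝ) : (vecMulVec x x).IsHermitian := by
  ext i j
  simp [vecMulVec_apply, mul_comm]

theorem dotProduct_vecMulVec_self_mulVec (x v : Fin n → ℝ) :
    v ⬝ᵥ vecMulVec x x *ᵥ v = (x ⬝ᵥ v) ^ 2 := by
  rw [vecMulVec_mulVec, dotProduct_smul, dotProduct_comm v x]
  simp [sq]

/-- The squared difference of two rank-one matrices is dominated by their sum. -/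
theorem dotProduct_sq_sub_vecMulVec_le {r : ℝ} {x y : Fin n → ℝ} (hx : x ⬝ᵥ x ≤ r)
    (hy : y ⬝ᵥ y ≤ r) (v : Fin n → ℝ) :
    0 ≤ v ⬝ᵥ ((2 * r) • (vecMulVec x x + vecMulVec y y) -
      (vecMulVec x x - vecMulVec y y) * (vecMulVec x x - vecMulVec y y)) *ᵥ v := by
  set D := vecMulVec x x - vecMulVec y y with hD
  have hDv : D *ᵥ v = (x ⬝ᵥ v) • x - (y ⬝ᵥ v) • y := by
    rw [hD, sub_mulVec, vecMulVec_mulVec, vecMulVec_mulVec]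
    simp
  have hDt : v ᵥ* D = D *ᵥ v := by
    have : Dᵀ = D := ((isHermitian_vecMulVec_self x).sub (isHermitian_vecMulVec_self y)).eq
    rw [← mulVec_transpose, this]
  have hsq : v ⬝ᵥ (D * D) *ᵥ v = (D *ᵥ v) ⬝ᵥ (D *ᵥ v) := by
    rw [← mulVec_mulVec, dotProduct_mulVec, hDt]
  have hpar : (D *ᵥ v) ⬝ᵥ (D *ᵥ v) ≤
      2 * (x ⬝ᵥ v) ^ 2 * (x ⬝ᵥ x) + 2 * (y ⬝ᵥ v) ^ 2 * (y ⬝ᵥ y) := by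
    have h : 0 ≤ ((x ⬝ᵥ v) • x + (y ⬝ᵥ v) • y) ⬝ᵥ ((x ⬝ᵥ v) • x + (y ⬝ᵥ v) • y) :=
      Finset.sum_nonneg fun i _ => mul_self_nonneg _
    rw [hDv]
    simp only [add_dotProduct, dotProduct_add, sub_dotProduct, dotProduct_sub, smul_dotProduct,
      dotProduct_smul, smul_eq_mul] at h ⊢
    linarith
  rw [sub_mulVec, dotProduct_sub, hsq, smul_mulVec, dotProduct_smul, add_mulVec, dotProduct_add,
    dotProduct_vecMulVec_self_mulVec, dotProduct_vecMulVec_self_mulVec, smul_eq_mul]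
  have h₁ := mul_le_mul_of_nonneg_left hx (sq_nonneg (x ⬝ᵥ v))
  have h₂ := mul_le_mul_of_nonneg_left hy (sq_nonneg (y ⬝ᵥ v))
  linarith

/-- The mean value inequality for exponentials of rank-one perturbations. -/
theorem mul_trace_sub_vecMulVec_mul_exp_le {r : ℝ} {x y : Fin n → ℝ} (hx : x ⬝ᵥ x ≤ r)
    (hy : y ⬝ᵥ y ≤ r) {V : Matrix (Fin n) (Fin n) ℝ} (hV : V.IsHermitian) (θ : ℝ) :
    θ * ((vecMulVec x x - vecMulVec y y) * (NormedSpace.exp (θ • (vecMulVec x x + V)) -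
      NormedSpace.exp (θ • (vecMulVec y y + V)))).trace ≤
    2 * r * θ ^ 2 * ((vecMulVec x x + vecMulVec y y) *
      (NormedSpace.exp (θ • (vecMulVec x x + V)) +
        NormedSpace.exp (θ • (vecMulVec y y + V)))).trace := by
  have hxV := (isHermitian_vecMulVec_self x).add hV
  have hyV := (isHermitian_vecMulVec_self y).add hV
  have h := mul_trace_sub_mul_exp_sub_exp_le hxV hyV θ
  rw [add_sub_add_right_eq_sub] at h
  have hx' := trace_mul_exp_nonneg hxV (dotProduct_sq_sub_vecMulVec_le hx hy) θ
  have hy' := trace_mul_exp_nonneg hyV (dotProduct_sq_sub_vecMulVec_le hx hy) θ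
  have hsum := mul_nonneg (sq_nonneg θ) (add_nonneg hx' hy')
  rw [← trace_add, ← Matrix.mul_add, Matrix.sub_mul, trace_sub, Matrix.smul_mul, trace_smul,
    smul_eq_mul] at hsum
  linarith

theorem sigmaMax_nonneg (A : Matrix (Fin n) (Fin n) ℝ) : 0 ≤ sigmaMax A := Real.sqrt_nonneg _

theorem dotProduct_mul_conjTranspose_mulVec {A : Matrix (Fin n) (Fin n) ℝ} (hA : A.IsHermitian)
    (v : Fin n → ℝ) : v ⬝ᵥ (A * Aᴴ) *ᵥ v = (A *ᵥ v) ⬝ᵥ (A *ᵥ v) := by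
  rw [hA.eq, ← mulVec_mulVec, dotProduct_mulVec, ← mulVec_transpose,
    ← conjTranspose_eq_transpose_of_trivial, hA.eq]

/-- The largest singular value bounds the Euclidean operator norm. -/
theorem dotProduct_mulVec_self_le_sigmaMax_sq {A : Matrix (Fin n) (Fin n) ℝ}
    (hA : A.IsHermitian) (v : Fin n → ℝ) :
    (A *ᵥ v) ⬝ᵥ (A *ᵥ v) ≤ sigmaMax A ^ 2 * (v ⬝ᵥ v) := by
  set hH := isHermitian_mul_conjTranspose_self A
  have h_nonneg : 0 ≤ ⨆ i, hH.eigenvalues i :=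
    Real.iSup_nonneg fun i => (posSemidef_self_mul_conjTranspose A).eigenvalues_nonneg i
  obtain ⟨U, -, hU, hHU⟩ := exists_eq_conj_diagonal_eigenvalues hH
  rw [← dotProduct_mul_conjTranspose_mulVec hA, sigmaMax, Real.sq_sqrt h_nonneg,
    ← sum_sq_transpose_mulVec hU, Finset.mul_sum]
  conv_lhs => rw [hHU]
  rw [dotProduct_conj_diagonal_mulVec]
  exact Finset.sum_le_sum fun k _ => mul_le_mul_of_nonneg_right
    (le_ciSup (Set.finite_range _).bddAbove k) (sq_nonneg _)

/-- The largest singular value is at most any bound for the Euclidean operator norm. -/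
theorem sigmaMax_le_of_dotProduct_mulVec_le {A : Matrix (Fin n) (Fin n) ℝ} (hA : A.IsHermitian)
    {a : ℝ} (ha : 0 ≤ a) (h : ∀ v, (A *ᵥ v) ⬝ᵥ (A *ᵥ v) ≤ a ^ 2 * (v ⬝ᵥ v)) :
    sigmaMax A ≤ a := by
  refine Real.sqrt_le_iff.mpr ⟨ha, Real.iSup_le (fun i => ?_) (sq_nonneg a)⟩
  set hH := isHermitian_mul_conjTranspose_self A
  set v : Fin n → ℝ := ⇑(hH.eigenvectorBasis i)
  have hv : v ⬝ᵥ v = 1 := by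
    have := EuclideanSpace.real_norm_sq_eq (hH.eigenvectorBasis i)
    rw [hH.eigenvectorBasis.orthonormal.1 i] at this
    rw [dotProduct]
    simpa only [sq, one_pow, mul_one] using this.symm
  have hi := h v
  rw [← dotProduct_mul_conjTranspose_mulVec hA, hH.mulVec_eigenvectorBasis, dotProduct_smul] at hi
  change hH.eigenvalues i * (v ⬝ᵥ v) ≤ _ at hi
  simpa [hv] using hi

/-- Quadratic forms are bounded by the largest singular value. -/
theorem dotProduct_mulVec_le_sigmaMax {A : Matrix (Fin n) (Fin n) ℝ} (hA : A.IsHermitian)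
    (v : Fin n → ℝ) : v ⬝ᵥ A *ᵥ v ≤ sigmaMax A * (v ⬝ᵥ v) := by
  have hcs : (v ⬝ᵥ A *ᵥ v) ^ 2 ≤ (v ⬝ᵥ v) * ((A *ᵥ v) ⬝ᵥ (A *ᵥ v)) := by
    simpa [dotProduct, sq] using Finset.sum_mul_sq_le_sq_mul_sq Finset.univ v (A *ᵥ v)
  have hv : 0 ≤ v ⬝ᵥ v := Finset.sum_nonneg fun i _ => mul_self_nonneg _
  refine abs_le_of_sq_le_sq' ?_ (mul_nonneg (sigmaMax_nonneg A) hv) |>.2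
  calc _ ≤ _ := hcs
    _ ≤ _ := mul_le_mul_of_nonneg_left (dotProduct_mulVec_self_le_sigmaMax_sq hA v) hv
    _ = _ := by ring

theorem trace_mul_exp_le_sigmaMax {M A : Matrix (Fin n) (Fin n) ℝ} (hM : M.IsHermitian)
    (hA : A.IsHermitian) (θ : ℝ) :
    (M * NormedSpace.exp (θ • A)).trace ≤ sigmaMax M * (NormedSpace.exp (θ • A)).trace := by
  have h := trace_mul_exp_nonneg (M := sigmaMax M • 1 - M) hA (fun v => by
    have := dotProduct_mulVec_le_sigmaMax hM v
    rw [sub_mulVec, dotProduct_sub, smul_mulVec, one_mulVec, dotProduct_smul, smul_eq_mul]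
    linarith) θ
  rw [Matrix.sub_mul, trace_sub, Matrix.smul_mul, trace_smul, Matrix.one_mul, smul_eq_mul] at h
  linarith

theorem trace_exp_nonneg {A : Matrix (Fin n) (Fin n) ℝ} (hA : A.IsHermitian) (θ : ℝ) :
    0 ≤ (NormedSpace.exp (θ • A)).trace := by
  simpa using trace_mul_exp_nonneg (M := 1) hA
    (fun v => by
      rw [one_mulVec]
      exact Finset.sum_nonneg fun i _ => mul_self_nonneg (v i)) θ

/-- Two-sided exponential traces detect a large singular value. -/
theorem exp_le_trace_exp_add_trace_exp_neg {A : Matrix (Fin n) (Fin n) ℝ} (hA : A.IsHermitian)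
    {a τ : ℝ} (ha : 0 ≤ a) (hτ : 0 ≤ τ) (h : a < sigmaMax A) :
    Real.exp (τ * a) ≤ (NormedSpace.exp (τ • A)).trace + (NormedSpace.exp (-τ • A)).trace := by
  obtain ⟨U, hU₁, hU₂, hAU⟩ := exists_eq_conj_diagonal_eigenvalues hA
  have htrace (s : ℝ) : (NormedSpace.exp (s • A)).trace =
      ∑ i, Real.exp (s * hA.eigenvalues i) := by
    conv_lhs => rw [hAU]
    rw [exp_smul_conj_diagonal hU₁, trace_mul_comm, ← Matrix.mul_assoc, hU₁, Matrix.one_mul,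
      trace_diagonal]
  obtain ⟨k, hk⟩ : ∃ k, a < |hA.eigenvalues k| := by
    by_contra! hle
    refine h.not_ge (sigmaMax_le_of_dotProduct_mulVec_le hA ha fun v => ?_)
    have hsq : A * Aᴴ = U * diagonal (fun k => hA.eigenvalues k ^ 2) * Uᵀ := by
      calc A * Aᴴ = U * diagonal hA.eigenvalues * Uᵀ * (U * diagonal hA.eigenvalues * Uᵀ) := by
            rw [hA.eq, ← hAU]
        _ = U * diagonal hA.eigenvalues * (Uᵀ * U) * diagonal hA.eigenvalues * Uᵀ := by
            simp only [Matrix.mul_assoc]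
        _ = _ := by
            rw [hU₁, Matrix.mul_one, Matrix.mul_assoc U, diagonal_mul_diagonal]
            simp only [sq]
    rw [← dotProduct_mul_conjTranspose_mulVec hA, hsq, dotProduct_conj_diagonal_mulVec,
      ← sum_sq_transpose_mulVec hU₂, Finset.mul_sum]
    exact Finset.sum_le_sum fun k _ => mul_le_mul_of_nonneg_right
      (sq_le_sq' (abs_le.mp (hle k)).1 (abs_le.mp (hle k)).2) (sq_nonneg _)
  rw [htrace, htrace, ← Finset.sum_add_distrib]
  refine le_trans ?_ (Finset.single_le_sum
    (f := fun i => Real.exp (τ * hA.eigenvalues i) + Real.exp (-τ * hA.eigenvalues i))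
    (fun i _ => by positivity) (Finset.mem_univ k))
  rcases lt_abs.mp hk with hk | hk
  · have := Real.exp_le_exp.mpr (mul_le_mul_of_nonneg_left hk.le hτ)
    linarith [Real.exp_pos (-τ * hA.eigenvalues k)]
  · have := Real.exp_le_exp.mpr (mul_le_mul_of_nonneg_left hk.le hτ)
    rw [← neg_mul_comm] at this
    linarith [Real.exp_pos (τ * hA.eigenvalues k)]

end MatrixLemmas

/-! ### Exponential moments of sums of independent rank-one matrices -/

section ExponentialMoments

theorem integrable_of_continuous_of_ae_mem_isCompact {E : Type*} [TopologicalSpace E]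
    [TopologicalSpace.PseudoMetrizableSpace E] [MeasurableSpace E] [OpensMeasurableSpace E]
    {ν : Measure E} [IsFiniteMeasure ν] {K : Set E} (hK : IsCompact K) (hν : ∀ᵐ x ∂ν, x ∈ K)
    {f : E → ℝ} (hf : Continuous f) : Integrable f ν := by
  obtain ⟨C, hC⟩ := hK.exists_bound_of_continuousOn hf.continuousOn
  exact Integrable.of_bound hf.measurable.aestronglyMeasurable C (hν.mono hC)

variable {n : ℕ}

theorem isCompact_setOf_dotProduct_self_le (r : ℝ) :
    IsCompact {x : Fin n → ℝ | x ⬝ᵥ x ≤ r} := by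
  refine Metric.isCompact_of_isClosed_isBounded
    (isClosed_le (by fun_prop) continuous_const)
    ((Metric.isBounded_closedBall (x := (0 : Fin n → ℝ)) (r := √r)).subset fun x hx => ?_)
  rw [mem_closedBall_zero_iff, pi_norm_le_iff_of_nonneg (Real.sqrt_nonneg r)]
  intro i
  refine Real.abs_le_sqrt (le_trans ?_ hx)
  rw [sq]
  exact Finset.single_le_sum (f := fun i => x i * x i) (fun i _ => mul_self_nonneg (x i))
    (Finset.mem_univ i)

theorem continuous_matrix_exp :
    Continuous (NormedSpace.exp : Matrix (Fin n) (Fin n) ℝ → Matrix (Fin n) (Fin n) ℝ) :=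
  open scoped Matrix.Norms.Operator in NormedSpace.exp_continuous

theorem continuous_vecMulVec_self :
    Continuous fun x : Fin n → ℝ => vecMulVec x x :=
  continuous_id.matrix_vecMulVec continuous_id

theorem hasDerivAt_trace_exp_smul (A : Matrix (Fin n) (Fin n) ℝ) (θ : ℝ) :
    HasDerivAt (fun s : ℝ => (NormedSpace.exp (s • A)).trace)
      (A * NormedSpace.exp (θ • A)).trace θ := by
  open scoped Matrix.Norms.Operator in
  have h := hasDerivAt_exp_smul_const' (𝕂 := ℝ) A θ
  exact (LinearMap.toContinuousLinearMap
    (traceLinearMap (Fin n) ℝ ℝ)).hasFDerivAt.comp_hasDerivAt θ h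

/-- Differentiation of the exponential trace moment of a bounded random matrix. -/
theorem hasDerivAt_integral_trace_exp_smul {E : Type*} [TopologicalSpace E]
    [TopologicalSpace.PseudoMetrizableSpace E] [MeasurableSpace E] [OpensMeasurableSpace E]
    {ν : Measure E} [IsFiniteMeasure ν] {K : Set E} (hK : IsCompact K) (hν : ∀ᵐ x ∂ν, x ∈ K)
    {W : E → Matrix (Fin n) (Fin n) ℝ} (hW : Continuous W) (θ : ℝ) :
    HasDerivAt (fun s : ℝ => ∫ x, (NormedSpace.exp (s • W x)).trace ∂ν)
      (∫ x, (W x * NormedSpace.exp (θ • W x)).trace ∂ν) θ := by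
  have hexp (s : ℝ) : Continuous fun x => NormedSpace.exp (s • W x) :=
    continuous_matrix_exp.comp (hW.const_smul s)
  have hjoint : Continuous fun p : ℝ × E => (W p.2 * NormedSpace.exp (p.1 • W p.2)).trace :=
    ((hW.comp continuous_snd).matrix_mul (continuous_matrix_exp.comp
      (continuous_fst.smul (hW.comp continuous_snd)))).matrix_trace
  obtain ⟨C, hC⟩ := ((isCompact_closedBall θ 1).prod hK).exists_bound_of_continuousOn
    hjoint.continuousOn
  refine (hasDerivAt_integral_of_dominated_loc_of_deriv_le (bound := fun _ => C)
    (Metric.closedBall_mem_nhds θ one_pos)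
    (.of_forall fun s => (hexp s).matrix_trace.measurable.aestronglyMeasurable)
    (integrable_of_continuous_of_ae_mem_isCompact hK hν (hexp θ).matrix_trace)
    (hW.matrix_mul (hexp θ)).matrix_trace.measurable.aestronglyMeasurable
    (hν.mono fun x hx s hs => hC (s, x) ⟨hs, hx⟩) (integrable_const C)
    (.of_forall fun x s _ => hasDerivAt_trace_exp_smul (W x) s)).2

variable {μ : Measure (Fin n → ℝ)} [IsProbabilityMeasure μ] {r : ℝ}
  {S : Matrix (Fin n) (Fin n) ℝ}

theorem integral_trace_vecMulVec_mul (hr : ∀ᵐ x ∂μ, x ⬝ᵥ x ≤ r)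
    (hS : ∀ i j, S i j = ∫ x, x i * x j ∂μ) (M : Matrix (Fin n) (Fin n) ℝ) :
    ∫ x, (vecMulVec x x * M).trace ∂μ = (S * M).trace := by
  have hint (i j : Fin n) : Integrable (fun x => x i * x j * M j i) μ :=
    integrable_of_continuous_of_ae_mem_isCompact (isCompact_setOf_dotProduct_self_le r) hr
      (by fun_prop)
  simp only [trace, diag_apply, mul_apply, vecMulVec_apply]
  rw [integral_finsetSum _ fun i _ => integrable_finsetSum _ fun j _ => hint i j]
  refine Finset.sum_congr rfl fun i _ => ?_
  rw [integral_finsetSum _ fun j _ => hint i j]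
  refine Finset.sum_congr rfl fun j _ => ?_
  rw [integral_mul_const, hS]

/-- Exchangeable pair bound in a single random vector. -/
theorem mul_integral_trace_vecMulVec_sub_mul_exp_le (hr : ∀ᵐ x ∂μ, x ⬝ᵥ x ≤ r)
    (hS : ∀ i j, S i j = ∫ x, x i * x j ∂μ) {V : Matrix (Fin n) (Fin n) ℝ}
    (hV : V.IsHermitian) (θ : ℝ) :
    θ * ∫ x, ((vecMulVec x x - S) * NormedSpace.exp (θ • (vecMulVec x x + V))).trace ∂μ ≤
      2 * r * θ ^ 2 *
        ∫ x, ((vecMulVec x x + S) * NormedSpace.exp (θ • (vecMulVec x x + V))).trace ∂μ := by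
  set G : (Fin n → ℝ) → Matrix (Fin n) (Fin n) ℝ :=
    fun x => NormedSpace.exp (θ • (vecMulVec x x + V)) with hG
  have hGc : Continuous G := continuous_matrix_exp.comp
    ((continuous_vecMulVec_self.add continuous_const).const_smul θ)
  set K := {x : Fin n → ℝ | x ⬝ᵥ x ≤ r}
  have hK : IsCompact K := isCompact_setOf_dotProduct_self_le r
  have hKK : ∀ᵐ p ∂μ.prod μ, p ∈ K ×ˢ K := by
    filter_upwards [Measure.quasiMeasurePreserving_fst.ae hr,
      Measure.quasiMeasurePreserving_snd.ae hr] with p h₁ h₂ using ⟨h₁, h₂⟩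
  set a : (Fin n → ℝ) → ℝ := fun x => (vecMulVec x x * G x).trace with ha
  set s : (Fin n → ℝ) → ℝ := fun x => (S * G x).trace with hs
  set b : (Fin n → ℝ) × (Fin n → ℝ) → ℝ := fun p => (vecMulVec p.1 p.1 * G p.2).trace with hb
  have hac : Continuous a := (continuous_vecMulVec_self.matrix_mul hGc).matrix_trace
  have hsc : Continuous s := (continuous_const.matrix_mul hGc).matrix_trace
  have hbc : Continuous b := ((continuous_vecMulVec_self.comp continuous_fst).matrix_mul
    (hGc.comp continuous_snd)).matrix_trace
  have hai := integrable_of_continuous_of_ae_mem_isCompact hK hr hac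
  have hsi := integrable_of_continuous_of_ae_mem_isCompact hK hr hsc
  have hint {f : (Fin n → ℝ) × (Fin n → ℝ) → ℝ} (hf : Continuous f) :
      Integrable f (μ.prod μ) :=
    integrable_of_continuous_of_ae_mem_isCompact (hK.prod hK) hKK hf
  have hb₁ : ∫ p, b p ∂μ.prod μ = ∫ x, s x ∂μ := by
    rw [integral_prod_symm _ (hint hbc)]
    simp only [hb, hs, integral_trace_vecMulVec_mul hr hS]
  have hb₂ : ∫ p : (Fin n → ℝ) × (Fin n → ℝ), b p.swap ∂μ.prod μ = ∫ x, s x ∂μ := by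
    rw [integral_prod_swap b, hb₁]
  have ha₁ : ∫ p : (Fin n → ℝ) × (Fin n → ℝ), a p.1 ∂μ.prod μ = ∫ x, a x ∂μ := by
    simp [integral_fun_fst]
  have ha₂ : ∫ p : (Fin n → ℝ) × (Fin n → ℝ), a p.2 ∂μ.prod μ = ∫ x, a x ∂μ := by
    simp [integral_fun_snd]
  have hi₁ : Integrable (fun p : (Fin n → ℝ) × (Fin n → ℝ) => a p.1) (μ.prod μ) :=
    hint (hac.comp continuous_fst)
  have hi₂ : Integrable (fun p : (Fin n → ℝ) × (Fin n → ℝ) => a p.2) (μ.prod μ) :=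
    hint (hac.comp continuous_snd)
  have hi₃ : Integrable (fun p : (Fin n → ℝ) × (Fin n → ℝ) => b p.swap) (μ.prod μ) :=
    hint (hbc.comp continuous_swap)
  have hA : Integrable (fun p : (Fin n → ℝ) × (Fin n → ℝ) => a p.1 + a p.2) (μ.prod μ) :=
    hi₁.add hi₂
  have hB : Integrable (fun p : (Fin n → ℝ) × (Fin n → ℝ) => b p + b p.swap) (μ.prod μ) :=
    (hint hbc).add hi₃
  have hmono : ∫ p, θ * (a p.1 + a p.2 - (b p + b p.swap)) ∂μ.prod μ ≤
      ∫ p, 2 * r * θ ^ 2 * (a p.1 + a p.2 + (b p + b p.swap)) ∂μ.prod μ := by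
    refine integral_mono_ae ((hA.sub hB).const_mul _) ((hA.add hB).const_mul _) ?_
    filter_upwards [hKK] with p hp
    have h := mul_trace_sub_vecMulVec_mul_exp_le hp.1 hp.2 hV θ
    simp only [Matrix.sub_mul, Matrix.add_mul, Matrix.mul_sub, Matrix.mul_add, trace_sub,
      trace_add] at h
    simp only [ha, hb, hG, Prod.fst_swap, Prod.snd_swap]
    linarith
  rw [integral_const_mul, integral_const_mul, integral_sub hA hB, integral_add hA hB,
    integral_add hi₁ hi₂, integral_add (hint hbc) hi₃, ha₁, ha₂, hb₁, hb₂] at hmono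
  simp only [Matrix.sub_mul, Matrix.add_mul, trace_sub, trace_add]
  rw [integral_sub hai hsi, integral_add hai hsi]
  linarith

/-- Integrals over a product space may be compared one coordinate at a time. -/
theorem integral_pi_le_integral_pi_of_insertNth {E : Type*} [MeasurableSpace E] {ν : Measure E}
    [SigmaFinite ν] {k : ℕ} (i : Fin (k + 1)) {f g : (Fin (k + 1) → E) → ℝ}
    (hf : Integrable f (Measure.pi fun _ => ν)) (hg : Integrable g (Measure.pi fun _ => ν))
    (h : ∀ Z : Fin k → E, ∫ x, f (i.insertNth x Z) ∂ν ≤ ∫ x, g (i.insertNth x Z) ∂ν) :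
    ∫ X, f X ∂Measure.pi (fun _ => ν) ≤ ∫ X, g X ∂Measure.pi (fun _ => ν) := by
  have he := (measurePreserving_piFinSuccAbove (fun _ => ν) i).symm
  have hf' := (he.integrable_comp_emb (MeasurableEquiv.measurableEmbedding _)).mpr hf
  have hg' := (he.integrable_comp_emb (MeasurableEquiv.measurableEmbedding _)).mpr hg
  rw [← he.integral_comp', ← he.integral_comp']
  exact (integral_prod_symm _ hf').trans_le
    ((integral_mono hf'.integral_prod_right hg'.integral_prod_right h).trans_eq
      (integral_prod_symm _ hg').symm)

/-- The centered sum of the rank-one matrices of a sample. -/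
def centeredSum {m : ℕ} (S : Matrix (Fin n) (Fin n) ℝ) (X : Fin m → Fin n → ℝ) :
    Matrix (Fin n) (Fin n) ℝ := ∑ i, (vecMulVec (X i) (X i) - S)

theorem isHermitian_centeredSum {m : ℕ} (hS : S.IsHermitian) (X : Fin m → Fin n → ℝ) :
    (centeredSum S X).IsHermitian := by
  rw [IsHermitian, centeredSum, conjTranspose_sum]
  exact Finset.sum_congr rfl fun i _ => ((isHermitian_vecMulVec_self (X i)).sub hS).eq

theorem continuous_centeredSum {m : ℕ} (S : Matrix (Fin n) (Fin n) ℝ) :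
    Continuous (centeredSum (m := m) S) :=
  continuous_finsetSum _ fun i _ =>
    (continuous_vecMulVec_self.comp (continuous_apply i)).sub continuous_const

theorem centeredSum_insertNth {k : ℕ} (i : Fin (k + 1)) (x : Fin n → ℝ)
    (Z : Fin k → Fin n → ℝ) :
    centeredSum S (i.insertNth x Z) = vecMulVec x x + (centeredSum S Z - S) := by
  rw [centeredSum, centeredSum, Fin.sum_univ_succAbove _ i]
  simp only [Fin.insertNth_apply_same, Fin.insertNth_apply_succAbove]
  abel

theorem isCompact_pi_setOf_dotProduct_self_le (m : ℕ) (r : ℝ) :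
    IsCompact {X : Fin m → Fin n → ℝ | ∀ i, X i ⬝ᵥ X i ≤ r} := by
  simpa [Set.pi] using isCompact_univ_pi
    fun _ : Fin m => isCompact_setOf_dotProduct_self_le (n := n) r

theorem ae_pi_dotProduct_self_le (m : ℕ) (hr : ∀ᵐ x ∂μ, x ⬝ᵥ x ≤ r) :
    ∀ᵐ X ∂Measure.pi (fun _ : Fin m => μ), ∀ i, X i ⬝ᵥ X i ≤ r :=
  ae_all_iff.mpr fun i =>
    (measurePreserving_eval (fun _ : Fin m => μ) i).quasiMeasurePreserving.ae hr

/-- The derivative of the exponential trace moment is bounded in terms of itself. -/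
theorem mul_integral_trace_centeredSum_mul_exp_le (m : ℕ) (hr : ∀ᵐ x ∂μ, x ⬝ᵥ x ≤ r)
    (hS : ∀ i j, S i j = ∫ x, x i * x j ∂μ) (hSh : S.IsHermitian) (θ : ℝ) :
    θ * ∫ X, (centeredSum S X * NormedSpace.exp (θ • centeredSum S X)).trace
        ∂Measure.pi (fun _ : Fin m => μ) ≤
      2 * r * θ ^ 2 * ∫ X, ((centeredSum S X + (2 * m : ℝ) • S) *
        NormedSpace.exp (θ • centeredSum S X)).trace ∂Measure.pi (fun _ : Fin m => μ) := by
  set P := Measure.pi (fun _ : Fin m => μ) with hP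
  set G : (Fin m → Fin n → ℝ) → Matrix (Fin n) (Fin n) ℝ :=
    fun X => NormedSpace.exp (θ • centeredSum S X) with hG
  have hGc : Continuous G :=
    continuous_matrix_exp.comp ((continuous_centeredSum S).const_smul θ)
  have hint {f : (Fin m → Fin n → ℝ) → ℝ} (hf : Continuous f) : Integrable f P :=
    integrable_of_continuous_of_ae_mem_isCompact (isCompact_pi_setOf_dotProduct_self_le m r)
      (ae_pi_dotProduct_self_le m hr) hf
  have hsub (i : Fin m) : Continuous fun X : Fin m → Fin n → ℝ =>
      ((vecMulVec (X i) (X i) - S) * G X).trace :=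
    (((continuous_vecMulVec_self.comp (continuous_apply i)).sub
      continuous_const).matrix_mul hGc).matrix_trace
  have hadd (i : Fin m) : Continuous fun X : Fin m → Fin n → ℝ =>
      ((vecMulVec (X i) (X i) + S) * G X).trace :=
    (((continuous_vecMulVec_self.comp (continuous_apply i)).add
      continuous_const).matrix_mul hGc).matrix_trace
  have hcoord (i : Fin m) : ∫ X, θ * ((vecMulVec (X i) (X i) - S) * G X).trace ∂P ≤
      ∫ X, 2 * r * θ ^ 2 * ((vecMulVec (X i) (X i) + S) * G X).trace ∂P := by
    obtain _ | k := m
    · exact i.elim0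
    refine integral_pi_le_integral_pi_of_insertNth i ((hint (hsub i)).const_mul _)
      ((hint (hadd i)).const_mul _) fun Z => ?_
    have h := mul_integral_trace_vecMulVec_sub_mul_exp_le hr hS
      ((isHermitian_centeredSum hSh Z).sub hSh) θ
    simpa only [hG, integral_const_mul, centeredSum_insertNth, Fin.insertNth_apply_same] using h
  have e₁ : ∫ X, (centeredSum S X * G X).trace ∂P =
      ∑ i, ∫ X, ((vecMulVec (X i) (X i) - S) * G X).trace ∂P := by
    rw [← integral_finsetSum _ fun i _ => hint (hsub i)]
    simp only [← trace_sum, ← Finset.sum_mul]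
    rfl
  have e₂ : ∫ X, ((centeredSum S X + (2 * m : ℝ) • S) * G X).trace ∂P =
      ∑ i, ∫ X, ((vecMulVec (X i) (X i) + S) * G X).trace ∂P := by
    rw [← integral_finsetSum _ fun i _ => hint (hadd i)]
    simp only [← trace_sum, ← Finset.sum_mul]
    congr! with X
    rw [centeredSum, Finset.sum_sub_distrib, Finset.sum_add_distrib, Finset.sum_const,
      Finset.card_univ, Fintype.card_fin, ← Nat.cast_smul_eq_nsmul ℝ, mul_smul, two_smul]
    abel
  rw [e₁, e₂, Finset.mul_sum, Finset.mul_sum]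
  refine Finset.sum_le_sum fun i _ => ?_
  rw [← integral_const_mul, ← integral_const_mul]
  exact hcoord i

/-- Subgaussian bound for the exponential trace moment of the centered sum. -/
theorem integral_trace_exp_centeredSum_le (m : ℕ) (hr : ∀ᵐ x ∂μ, x ⬝ᵥ x ≤ r) (hr₀ : 0 ≤ r)
    (hS : ∀ i j, S i j = ∫ x, x i * x j ∂μ) (hSh : S.IsHermitian) {θ : ℝ}
    (hθ : 4 * r * |θ| ≤ 1) :
    ∫ X, (NormedSpace.exp (θ • centeredSum S X)).trace ∂Measure.pi (fun _ : Fin m => μ) ≤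
      n * Real.exp (4 * r * m * sigmaMax S * θ ^ 2) := by
  set P := Measure.pi (fun _ : Fin m => μ) with hP
  have hK := isCompact_pi_setOf_dotProduct_self_le (n := n) m r
  have hK' := ae_pi_dotProduct_self_le m hr
  set φ : ℝ → ℝ := fun s => ∫ X, (NormedSpace.exp (s • centeredSum S X)).trace ∂P with hφ
  set φ' : ℝ → ℝ := fun s =>
    ∫ X, (centeredSum S X * NormedSpace.exp (s • centeredSum S X)).trace ∂P with hφ'
  have hderiv (s : ℝ) : HasDerivAt φ (φ' s) s :=
    hasDerivAt_integral_trace_exp_smul hK hK' (continuous_centeredSum S) s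
  have hφ_nonneg (s : ℝ) : 0 ≤ φ s :=
    integral_nonneg fun X => trace_exp_nonneg (isHermitian_centeredSum hSh X) s
  have hexp (s : ℝ) : Continuous fun X : Fin m → Fin n → ℝ =>
      NormedSpace.exp (s • centeredSum S X) :=
    continuous_matrix_exp.comp ((continuous_centeredSum S).const_smul s)
  have hself (s : ℝ) : s * φ' s ≤ 2 * r * s ^ 2 * (φ' s + 2 * m * sigmaMax S * φ s) := by
    refine (mul_integral_trace_centeredSum_mul_exp_le m hr hS hSh s).trans
      (mul_le_mul_of_nonneg_left ?_ (by positivity))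
    have i₁ : Integrable (fun X =>
        (centeredSum S X * NormedSpace.exp (s • centeredSum S X)).trace) P :=
      integrable_of_continuous_of_ae_mem_isCompact hK hK'
        ((continuous_centeredSum S).matrix_mul (hexp s)).matrix_trace
    have i₂ : Integrable (fun X => (NormedSpace.exp (s • centeredSum S X)).trace) P :=
      integrable_of_continuous_of_ae_mem_isCompact hK hK' (hexp s).matrix_trace
    rw [hφ', hφ, ← integral_const_mul, ← integral_add i₁ (i₂.const_mul _)]
    refine integral_mono (integrable_of_continuous_of_ae_mem_isCompact hK hK'
      (((continuous_centeredSum S).add continuous_const).matrix_mul (hexp s)).matrix_trace)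
      (i₁.add (i₂.const_mul _)) fun X => ?_
    have h := mul_le_mul_of_nonneg_left (trace_mul_exp_le_sigmaMax hSh
      (isHermitian_centeredSum hSh X) s) (by positivity : (0 : ℝ) ≤ 2 * m)
    simp only [Matrix.add_mul, trace_add, Matrix.smul_mul, trace_smul, smul_eq_mul]
    linarith
  set c : ℝ := 4 * r * m * sigmaMax S * θ ^ 2 with hc
  have hσ := sigmaMax_nonneg S
  have hbound {u : ℝ} (hu : u ∈ Set.Ioo (0 : ℝ) 1) :
      φ' (u * θ) * θ ≤ 2 * c * u * φ (u * θ) := by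
    have h := hself (u * θ)
    have hsmall : 2 * r * (u * θ) ≤ 1 / 2 := by
      have h₁ : u * θ ≤ |θ| := by
        have h₂ := mul_le_mul_of_nonneg_left (le_abs_self θ) hu.1.le
        nlinarith [abs_nonneg θ, hu.2]
      nlinarith
    have hR : 0 ≤ c * u * φ (u * θ) := by
      have := hφ_nonneg (u * θ)
      have := hu.1.le
      positivity
    have hkey : (φ' (u * θ) * θ) * (1 - 2 * r * (u * θ)) ≤ c * u * φ (u * θ) := by
      refine le_of_mul_le_mul_left ?_ hu.1
      rw [hc]
      linarith
    rcases le_total (φ' (u * θ) * θ) 0 with hneg | hpos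
    · linarith
    · nlinarith [mul_le_mul_of_nonneg_left hsmall hpos]
  set F : ℝ → ℝ := fun u => φ (u * θ) * Real.exp (-(c * u ^ 2)) with hF
  have hFderiv (u : ℝ) : HasDerivAt F
      ((φ' (u * θ) * θ - 2 * c * u * φ (u * θ)) * Real.exp (-(c * u ^ 2))) u := by
    have h₁ : HasDerivAt (fun u => φ (u * θ)) (φ' (u * θ) * θ) u :=
      HasDerivAt.comp (h₂ := φ) u (hderiv (u * θ)) (hasDerivAt_mul_const θ)
    have h₂ : HasDerivAt (fun u : ℝ => Real.exp (-(c * u ^ 2)))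
        (Real.exp (-(c * u ^ 2)) * -(c * (2 * u))) u := by
      simpa using (((hasDerivAt_pow 2 u).const_mul c).neg).exp
    exact (h₁.mul h₂).congr_deriv (by ring)
  have hanti : AntitoneOn F (Set.Icc 0 1) := by
    refine antitoneOn_of_deriv_nonpos (convex_Icc 0 1)
      (fun u _ => (hFderiv u).continuousAt.continuousWithinAt)
      (fun u _ => (hFderiv u).differentiableAt.differentiableWithinAt) fun u hu => ?_
    rw [interior_Icc] at hu
    rw [(hFderiv u).deriv]
    exact mul_nonpos_of_nonpos_of_nonneg (sub_nonpos.mpr (hbound hu)) (Real.exp_pos _).le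
  have hfin := hanti (Set.left_mem_Icc.mpr zero_le_one) (Set.right_mem_Icc.mpr zero_le_one)
    zero_le_one
  have hφ₀ : φ 0 = n := by simp [hφ, NormedSpace.exp_zero, trace_one]
  simp only [hF, one_mul, zero_mul, hφ₀, one_pow, mul_one] at hfin
  rw [Real.exp_neg, ← div_eq_mul_inv, div_le_iff₀ (Real.exp_pos c)] at hfin
  simpa using hfin

end ExponentialMoments

/-! ### Concentration of the sample covariance matrix -/

section Concentration

variable {n : ℕ}

theorem sigmaMax_zero : sigmaMax (0 : Matrix (Fin n) (Fin n) ℝ) = 0 :=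
  le_antisymm (sigmaMax_le_of_dotProduct_mulVec_le isHermitian_zero le_rfl (by simp))
    (sigmaMax_nonneg 0)

theorem centeredSum_eq_smul_covM_sub {m : ℕ} (hm : m ≠ 0) (S : Matrix (Fin n) (Fin n) ℝ)
    (X : Fin m → Fin n → ℝ) : centeredSum S X = (m : ℝ) • (covM X - S) := by
  rw [centeredSum, covM, smul_sub, smul_inv_smul₀ (Nat.cast_ne_zero.mpr hm),
    Finset.sum_sub_distrib, Finset.sum_const, Finset.card_univ, Fintype.card_fin,
    Nat.cast_smul_eq_nsmul]

theorem isHermitian_covM {m : ℕ} (X : Fin m → Fin n → ℝ) : (covM X).IsHermitian := by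
  rw [IsHermitian, covM, conjTranspose_smul, conjTranspose_sum, star_trivial]
  exact congrArg _ (Finset.sum_congr rfl fun i _ => (isHermitian_vecMulVec_self (X i)).eq)

variable {μ : Measure (Fin n → ℝ)} {r : ℝ} {S : Matrix (Fin n) (Fin n) ℝ}

theorem isHermitian_of_eq_integral (hS : ∀ i j, S i j = ∫ x, x i * x j ∂μ) :
    S.IsHermitian := by
  ext i j
  simp [hS, mul_comm]

theorem eq_zero_of_ae_dotProduct_self_le_zero (h : ∀ᵐ x ∂μ, x ⬝ᵥ x ≤ 0)
    (hS : ∀ i j, S i j = ∫ x, x i * x j ∂μ) : S = 0 := by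
  ext i j
  rw [hS, Matrix.zero_apply]
  refine integral_eq_zero_of_ae (h.mono fun x hx => ?_)
  have hx₀ : x = 0 := dotProduct_self_eq_zero.mp
    (hx.antisymm (Finset.sum_nonneg fun i _ => mul_self_nonneg (x i)))
  simp [hx₀]

variable [IsProbabilityMeasure μ]

theorem ae_dotProduct_self_le_zero_of_sigmaMax_eq_zero (hr : ∀ᵐ x ∂μ, x ⬝ᵥ x ≤ r)
    (hS : ∀ i j, S i j = ∫ x, x i * x j ∂μ) (h : sigmaMax S = 0) :
    ∀ᵐ x ∂μ, x ⬝ᵥ x ≤ 0 := by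
  have htrace : ∫ x : Fin n → ℝ, x ⬝ᵥ x ∂μ = S.trace := by
    simpa [trace_vecMulVec] using integral_trace_vecMulVec_mul hr hS 1
  have hle : S.trace ≤ 0 := by
    refine Finset.sum_nonpos fun i _ => ?_
    simpa [h] using dotProduct_mulVec_le_sigmaMax (isHermitian_of_eq_integral hS) (Pi.single i 1)
  have hnonneg (x : Fin n → ℝ) : 0 ≤ x ⬝ᵥ x :=
    Finset.sum_nonneg fun i _ => mul_self_nonneg (x i)
  have hzero : ∫ x : Fin n → ℝ, x ⬝ᵥ x ∂μ = 0 :=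
    (htrace.trans_le hle).antisymm (integral_nonneg hnonneg)
  have := (integral_eq_zero_iff_of_nonneg hnonneg (integrable_of_continuous_of_ae_mem_isCompact
    (isCompact_setOf_dotProduct_self_le r) hr (by fun_prop))).mp hzero
  exact this.mono fun x hx => hx.le

/-- Matrix Bernstein tail bound for the sample covariance. -/
theorem measureReal_lt_sigmaMax_covM_sub_le {m : ℕ} (hm : m ≠ 0)
    (hr : ∀ᵐ x ∂μ, x ⬝ᵥ x ≤ r) (hr₀ : 0 < r) (hS : ∀ i j, S i j = ∫ x, x i * x j ∂μ)
    {ε : ℝ} (hε : ε ∈ Set.Ioo (0 : ℝ) 1) :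
    (Measure.pi fun _ : Fin m => μ).real {X | ε * sigmaMax S < sigmaMax (covM X - S)} ≤
      2 * n * Real.exp (-(m * ε ^ 2 * sigmaMax S / (16 * r))) := by
  have hSh := isHermitian_of_eq_integral hS
  set P := Measure.pi fun _ : Fin m => μ
  obtain ⟨hε₀, hε₁⟩ := hε
  set θ := ε / (8 * r) with hθ
  have hθ₀ : 0 < θ := by positivity
  have hsmall : 4 * r * |θ| ≤ 1 := by
    rw [abs_of_pos hθ₀, hθ]
    field_simp
    linarith
  have hσ := sigmaMax_nonneg S
  set f : ℝ → (Fin m → Fin n → ℝ) → ℝ :=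
    fun s X => (NormedSpace.exp (s • centeredSum S X)).trace with hf
  have hfi (s : ℝ) : Integrable (f s) P :=
    integrable_of_continuous_of_ae_mem_isCompact (isCompact_pi_setOf_dotProduct_self_le m r)
      (ae_pi_dotProduct_self_le m hr) (continuous_matrix_exp.comp
        ((continuous_centeredSum S).const_smul s)).matrix_trace
  have hsubset : {X | ε * sigmaMax S < sigmaMax (covM X - S)} ⊆
      {X | Real.exp (m * θ * (ε * sigmaMax S)) ≤ f θ X + f (-θ) X} := by
    intro X hX
    have h := exp_le_trace_exp_add_trace_exp_neg ((isHermitian_covM X).sub hSh)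
      (by positivity) (by positivity : 0 ≤ m * θ) hX
    simp only [Set.mem_ofPred_eq, hf, centeredSum_eq_smul_covM_sub hm, smul_smul]
    rwa [mul_comm θ, mul_comm (-θ), mul_neg]
  have hmarkov := mul_meas_ge_le_integral_of_nonneg (μ := P) (f := fun X => f θ X + f (-θ) X)
    (.of_forall fun X => add_nonneg (trace_exp_nonneg (isHermitian_centeredSum hSh X) θ)
      (trace_exp_nonneg (isHermitian_centeredSum hSh X) (-θ)))
    ((hfi θ).add (hfi (-θ))) (Real.exp (m * θ * (ε * sigmaMax S)))
  rw [integral_add (hfi θ) (hfi (-θ))] at hmarkov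
  have h₁ := integral_trace_exp_centeredSum_le m hr hr₀.le hS hSh hsmall
  have h₂ := integral_trace_exp_centeredSum_le m hr hr₀.le hS hSh
    (θ := -θ) (by rwa [abs_neg])
  rw [neg_sq] at h₂
  have hexponent : -(m * ε ^ 2 * sigmaMax S / (16 * r)) =
      4 * r * m * sigmaMax S * θ ^ 2 - m * θ * (ε * sigmaMax S) := by
    rw [hθ]
    field_simp
    ring
  refine (measureReal_mono hsubset).trans ?_
  rw [hexponent, Real.exp_sub, ← mul_div_assoc (2 * (n : ℝ)), le_div_iff₀ (Real.exp_pos _), mul_comm]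
  linarith

end Concentration

/-- Vershynin, Cor. 5.52: convergence of the sample covariance matrix in
spectral norm, for a zero-mean distribution supported in a ball of radius `√r`. -/
theorem sample_covariance_convergence :
    ∃ C : ℝ, 0 < C ∧
      ∀ (n : ℕ) (μ : Measure (Fin n → ℝ)), IsProbabilityMeasure μ →
      ∀ r : ℝ, μ {x | ∑ i, (x i) ^ 2 ≤ r} = 1 →
      (∀ i, ∫ x, x i ∂μ = 0) →
      ∀ Spop : Matrix (Fin n) (Fin n) ℝ, (∀ i j, Spop i j = ∫ x, x i * x j ∂μ) →
      ∀ ε t : ℝ, ε ∈ Set.Ioo (0 : ℝ) 1 → 1 ≤ t →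
      ∀ m : ℕ, C * (t / ε) ^ 2 * (sigmaMax Spop)⁻¹ * r * Real.log n ≤ m →
        ENNReal.ofReal (1 - (n : ℝ) ^ (-(t ^ 2))) ≤
          Measure.pi (fun _ : Fin m => μ)
            {X | sigmaMax (covM X - Spop) ≤ ε * sigmaMax Spop} := by
  refine ⟨48, by norm_num, fun n μ hμ r hball _ S hS ε t hε ht m hm => ?_⟩
  set P := Measure.pi fun _ : Fin m => μ
  have hr : ∀ᵐ x ∂μ, x ⬝ᵥ x ≤ r := by
    have hmeas : MeasurableSet {x : Fin n → ℝ | ∑ i, x i ^ 2 ≤ r} :=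
      measurableSet_le (by fun_prop) measurable_const
    filter_upwards [(mem_ae_iff_prob_eq_one hmeas).mpr hball] with x hx
    simpa [dotProduct, sq] using hx
  have hone (h : ∀ᵐ X ∂P, sigmaMax (covM X - S) ≤ ε * sigmaMax S) :
      ENNReal.ofReal (1 - (n : ℝ) ^ (-(t ^ 2))) ≤
        P {X | sigmaMax (covM X - S) ≤ ε * sigmaMax S} := by
    have h₁ : P {X | sigmaMax (covM X - S) ≤ ε * sigmaMax S} = P Set.univ :=
      measure_congr (Filter.eventuallyEq_univ.mpr h)
    rw [h₁, measure_univ, ENNReal.ofReal_le_one]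
    linarith [Real.rpow_nonneg n.cast_nonneg (-(t ^ 2))]
  rcases (sigmaMax_nonneg S).eq_or_lt with hσ | hσ
  · have hzero := ae_dotProduct_self_le_zero_of_sigmaMax_eq_zero hr hS hσ.symm
    have hS₀ := eq_zero_of_ae_dotProduct_self_le_zero hzero hS
    refine hone ((ae_pi_dotProduct_self_le m hzero).mono fun X hX => ?_)
    have hX₀ (i : Fin m) : X i = 0 := dotProduct_self_eq_zero.mp
      ((hX i).antisymm (Finset.sum_nonneg fun j _ => mul_self_nonneg (X i j)))
    have hcov : covM X = 0 := by simp [covM, hX₀]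
    simp [hcov, hS₀, sigmaMax_zero]
  have hr₀ : 0 < r := by
    by_contra! hr_neg
    have hS₀ := eq_zero_of_ae_dotProduct_self_le_zero (hr.mono fun x hx => hx.trans hr_neg) hS
    rw [hS₀, sigmaMax_zero] at hσ
    exact hσ.false
  have hn : n ≠ 0 := by
    rintro rfl
    rw [Subsingleton.elim S 0, sigmaMax_zero] at hσ
    exact hσ.false
  rcases eq_or_ne n 1 with rfl | hn₁
  · simp
  have hn₂ : (2 : ℝ) ≤ n := by exact_mod_cast (by omega : 2 ≤ n)
  have hlog : 0 < Real.log n := Real.log_pos (by linarith)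
  have hε₀ := hε.1
  have ht₀ : 0 < t := by linarith
  have hm_pos : (0 : ℝ) < m := lt_of_lt_of_le (by positivity) hm
  have htail := measureReal_lt_sigmaMax_covM_sub_le (Nat.cast_pos.mp hm_pos).ne' hr hr₀ hS hε
  have hexponent : 3 * t ^ 2 * Real.log n ≤ m * ε ^ 2 * sigmaMax S / (16 * r) := by
    rw [le_div_iff₀ (by positivity)]
    calc 3 * t ^ 2 * Real.log n * (16 * r) =
        48 * (t / ε) ^ 2 * (sigmaMax S)⁻¹ * r * Real.log n * (ε ^ 2 * sigmaMax S) := by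
          field_simp
          ring
      _ ≤ m * (ε ^ 2 * sigmaMax S) := by gcongr
      _ = _ := by ring
  have hsmall : P.real {X | ε * sigmaMax S < sigmaMax (covM X - S)} ≤ (n : ℝ) ^ (-(t ^ 2)) := by
    have hn_pos : (0 : ℝ) < n := by linarith
    calc _ ≤ 2 * n * Real.exp (-(m * ε ^ 2 * sigmaMax S / (16 * r))) := htail
      _ ≤ n * n * Real.exp (-(3 * t ^ 2 * Real.log n)) := by gcongr
      _ = Real.exp (Real.log n * (2 - 3 * t ^ 2)) := by
          conv_lhs => rw [← Real.exp_log hn_pos]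
          rw [Real.log_exp, ← Real.exp_add, ← Real.exp_add]
          ring_nf
      _ ≤ Real.exp (Real.log n * (-(t ^ 2))) := by
          gcongr
          nlinarith
      _ = _ := (Real.rpow_def_of_pos hn_pos _).symm
  have hcompl : {X | sigmaMax (covM X - S) ≤ ε * sigmaMax S}ᶜ =
      {X : Fin m → Fin n → ℝ | ε * sigmaMax S < sigmaMax (covM X - S)} := by
    ext X
    simp
  have hunion : 1 ≤ P.real {X | sigmaMax (covM X - S) ≤ ε * sigmaMax S} +
      P.real {X | ε * sigmaMax S < sigmaMax (covM X - S)} := by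
    have h := measureReal_union_le (μ := P) {X | sigmaMax (covM X - S) ≤ ε * sigmaMax S}
      {X | sigmaMax (covM X - S) ≤ ε * sigmaMax S}ᶜ
    rwa [Set.union_compl_self, probReal_univ, hcompl] at h
  rw [ENNReal.ofReal_le_iff_le_toReal (measure_ne_top _ _)]
  change _ ≤ P.real _
  linarith

end
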